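/- Fix a positive integer n and natural numbers k, l. The set of matrices W : Matrix (Fin l → Fin n) (Fin k → Fin n) ℂ satisfying W * g^{⊗k} = g^{⊗l} * W for every g in the hyperoctahedral group H_n — i.e. every real orthogonal n×n matrix g (g * gᵀ = 1) with every entry g i j belonging to {-1, 0, 1} — is a ℂ-subspace, and it is equal to the ℂ-linear span of the set {D_π : π a Setoid on Fin l ⊕ Fin k all of whose equivalence classes have even cardinality}. (This characterises the weight matrices of hyperoctahedral-group equivariant layers, a characterisation not previously appearing in the machine learning literature.) -/

import Mathlib

open Matrix
open scoped Classical

/-- The partition matrix `D_π` of a set partition (Setoid) `π` of `α ⊕ β`: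
`D_π I J = 1` if `Sum.elim I J` is constant on every block of `π`, else `0`. -/
noncomputable def Dmat (n : ℕ) {α β : Type*} (π : Setoid (α ⊕ β)) :
    Matrix (α → Fin n) (β → Fin n) ℂ :=
  Matrix.of fun I J =>
    if ∀ x y : α ⊕ β, π.r x y → Sum.elim I J x = Sum.elim I J y then 1 else 0

/-- The `k`-fold tensor power of a real `n × n` matrix, as a complex matrix:
`g^{⊗k} I J = ∏ a, g (I a) (J a)`. -/
noncomputable def tpow (n k : ℕ) (g : Matrix (Fin n) (Fin n) ℝ) :
    Matrix (Fin k → Fin n) (Fin k → Fin n) ℂ :=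
  Matrix.of fun I J => ∏ a : Fin k, ((g (I a) (J a) : ℝ) : ℂ)

/-- A set saturated for an equivalence relation with even classes has even cardinality. -/
theorem even_ncard_of_saturated {X : Type*} [Finite X] {π : Setoid X}
    (hπ : ∀ s ∈ π.classes, Even s.ncard) {S : Set X}
    (hS : ∀ x y, π.r x y → x ∈ S → y ∈ S) : Even S.ncard := by
  have := Fintype.ofFinite X
  rw [Set.ncard_eq_toFinset_card', even_iff_two_dvd,
    Finset.card_eq_sum_card_image (Quotient.mk π)]
  refine Finset.dvd_sum fun q hq => ?_
  obtain ⟨x, hx, rfl⟩ := Finset.mem_image.1 hq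
  rw [Set.mem_toFinset] at hx
  rw [← even_iff_two_dvd]
  have hx' := hπ _ (π.mem_classes x)
  rw [Set.ncard_eq_toFinset_card'] at hx'
  refine (congrArg Even (congrArg Finset.card (Finset.ext fun y => ?_))).mpr hx'
  simp only [Finset.mem_filter, Set.mem_toFinset, Set.mem_ofPred_eq, Quotient.eq]
  exact ⟨fun h => h.2, fun h => ⟨hS x y (π.symm h) hx, h⟩⟩

/-- Coarsening an equivalence relation with even classes keeps the classes even. -/
theorem even_classes_mono {X : Type*} [Finite X] {π ρ : Setoid X} (h : π ≤ ρ)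
    (hπ : ∀ s ∈ π.classes, Even s.ncard) : ∀ s ∈ ρ.classes, Even s.ncard := by
  rintro s ⟨x, rfl⟩
  exact even_ncard_of_saturated hπ fun y z hyz hy => ρ.trans (ρ.symm (h hyz)) hy

theorem finite_setoid (X : Type*) [Finite X] : Finite (Setoid X) :=
  Finite.of_injective (fun (π : Setoid X) (x y : X) => π.r x y) fun _ _ h =>
    Setoid.ext fun x y => iff_of_eq (congrFun (congrFun h x) y)

/-- Functions with the same kernel differ by a permutation of the target. -/
theorem exists_perm_comp_eq_of_ker_eq {X Y : Type*} [Finite Y] {f f' : X → Y}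
    (h : Setoid.ker f = Setoid.ker f') : ∃ σ : Equiv.Perm Y, ∀ x, σ (f x) = f' x := by
  let e : Set.range f ≃ Set.range f' :=
    (Setoid.quotientKerEquivRange f).symm.trans
      ((Quotient.congrRight fun x y => by rw [h]).trans (Setoid.quotientKerEquivRange f'))
  refine ⟨Equiv.extendSubtype e, fun x => ?_⟩
  rw [Equiv.extendSubtype_apply_of_mem e (f x) ⟨x, rfl⟩]
  have hx : (Setoid.quotientKerEquivRange f).symm ⟨f x, x, rfl⟩ = Quotient.mk _ x := by
    rw [Equiv.symm_apply_eq]; rfl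
  change ((Setoid.quotientKerEquivRange f' (Quotient.congrRight _
    ((Setoid.quotientKerEquivRange f).symm ⟨f x, x, rfl⟩)) : Set.range f') : Y) = f' x
  rw [hx]
  rfl

/-- The indicator matrix of the multi-indices whose kernel is exactly `ρ`. -/
noncomputable def kerMat (n : ℕ) {α β : Type*} (ρ : Setoid (α ⊕ β)) :
    Matrix (α → Fin n) (β → Fin n) ℂ :=
  Matrix.of fun I J => if Setoid.ker (Sum.elim I J) = ρ then 1 else 0

theorem Dmat_apply (n : ℕ) {α β : Type*} (π : Setoid (α ⊕ β)) (I : α → Fin n)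
    (J : β → Fin n) : Dmat n π I J = if π ≤ Setoid.ker (Sum.elim I J) then 1 else 0 := by
  rw [Dmat, Matrix.of_apply]
  rfl

theorem Dmat_eq_sum_kerMat (n : ℕ) {α β : Type*} [Fintype (Setoid (α ⊕ β))]
    (π : Setoid (α ⊕ β)) : Dmat n π = ∑ ρ with π ≤ ρ, kerMat n ρ := by
  ext I J
  simp [Dmat_apply, Matrix.sum_apply, kerMat, Finset.sum_ite_eq]

theorem kerMat_mem_span (n : ℕ) {α β : Type*} [Finite α] [Finite β] (ρ : Setoid (α ⊕ β))
    (hρ : ∀ s ∈ ρ.classes, Even s.ncard) :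
    kerMat n ρ ∈ Submodule.span ℂ {D : Matrix (α → Fin n) (β → Fin n) ℂ |
      ∃ π : Setoid (α ⊕ β), (∀ s ∈ π.classes, Even s.ncard) ∧ D = Dmat n π} := by
  have := finite_setoid (α ⊕ β)
  have := Fintype.ofFinite (Setoid (α ⊕ β))
  induction ρ using WellFoundedGT.induction with
  | ind ρ ih =>
    have hsum : Dmat n ρ = kerMat n ρ + ∑ π with ρ < π, kerMat n π := by
      rw [Dmat_eq_sum_kerMat, ← Finset.sum_insert (by simp)]
      congr 1
      ext π
      simp [le_iff_eq_or_lt, eq_comm]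
    rw [← sub_eq_iff_eq_add] at hsum
    rw [← hsum]
    refine Submodule.sub_mem _ (Submodule.subset_span ⟨ρ, hρ, rfl⟩)
      (Submodule.sum_mem _ fun π hπ => ?_)
    have hlt : ρ < π := (Finset.mem_filter.1 hπ).2
    exact ih π hlt (even_classes_mono hlt.le hρ)

/-- The signed permutation matrix with signs `ε` and permutation `σ`. -/
noncomputable def signedPerm {n : ℕ} (σ : Equiv.Perm (Fin n)) (ε : Fin n → ℝ) :
    Matrix (Fin n) (Fin n) ℝ :=
  Matrix.of fun i j => if σ i = j then ε i else 0

theorem exists_eq_signedPerm {n : ℕ} {g : Matrix (Fin n) (Fin n) ℝ} (hg : g * gᵀ = 1)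
    (hent : ∀ i j, g i j ∈ ({-1, 0, 1} : Set ℝ)) :
    ∃ (σ : Equiv.Perm (Fin n)) (ε : Fin n → ℝ),
      (∀ i, ε i = 1 ∨ ε i = -1) ∧ g = signedPerm σ ε := by
  have hrow : ∀ i, ∑ j, g i j * g i j = 1 := fun i => by
    simpa [Matrix.mul_apply] using congrFun (congrFun hg i) i
  have hg' : gᵀ * g = 1 := mul_eq_one_comm.1 hg
  have hcol : ∀ j, ∑ i, g i j * g i j = 1 := fun j => by
    simpa [Matrix.mul_apply] using congrFun (congrFun hg' j) j
  have hsq : ∀ i j, g i j ≠ 0 → g i j * g i j = 1 := fun i j h => by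
    rcases hent i j with h' | h' | h' <;> simp_all
  have huniq : ∀ v : Fin n → ℝ, ∑ j, v j * v j = 1 → (∀ j, v j ≠ 0 → v j * v j = 1) →
      ∀ a b, v a ≠ 0 → v b ≠ 0 → a = b := by
    intro v hv h1 a b ha hb
    by_contra hab
    have := Finset.sum_le_sum_of_subset_of_nonneg (f := fun j => v j * v j)
      (Finset.subset_univ {a, b}) fun j _ _ => mul_self_nonneg _
    rw [Finset.sum_pair hab, h1 a ha, h1 b hb, hv] at this
    norm_num at this
  have hex : ∀ i, ∃ j, g i j ≠ 0 := fun i => by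
    by_contra! h
    simpa [h] using hrow i
  choose s hs using hex
  have hinj : Function.Injective s := fun a b hab =>
    huniq (fun i => g i (s a)) (hcol _) (fun i => hsq i _) a b (hs a) (hab ▸ hs b)
  refine ⟨Equiv.ofBijective s (Finite.injective_iff_bijective.1 hinj), fun i => g i (s i),
    fun i => mul_self_eq_one_iff.1 (hsq i _ (hs i)), ?_⟩
  ext i j
  simp only [signedPerm, Matrix.of_apply, Equiv.ofBijective_apply]
  split_ifs with h
  · rw [h]
  · by_contra h0
    exact h (huniq (g i) (hrow i) (hsq i) _ _ (hs i) h0)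

theorem signedPerm_mul_transpose {n : ℕ} (σ : Equiv.Perm (Fin n)) {ε : Fin n → ℝ}
    (hε : ∀ i, ε i = 1 ∨ ε i = -1) : signedPerm σ ε * (signedPerm σ ε)ᵀ = 1 := by
  ext i j
  rcases eq_or_ne i j with rfl | hij
  · simpa [Matrix.mul_apply, signedPerm] using mul_self_eq_one_iff.2 (hε i)
  · simp [Matrix.mul_apply, signedPerm, hij]

theorem signedPerm_mem {n : ℕ} (σ : Equiv.Perm (Fin n)) {ε : Fin n → ℝ}
    (hε : ∀ i, ε i = 1 ∨ ε i = -1) (i j : Fin n) :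
    signedPerm σ ε i j ∈ ({-1, 0, 1} : Set ℝ) := by
  simp only [signedPerm, Matrix.of_apply]
  split_ifs
  · rcases hε i with h | h <;> simp [h]
  · simp

theorem tpow_signedPerm (n k : ℕ) (σ : Equiv.Perm (Fin n)) (ε : Fin n → ℝ)
    (I J : Fin k → Fin n) :
    tpow n k (signedPerm σ ε) I J = if σ ∘ I = J then ∏ a, (ε (I a) : ℂ) else 0 := by
  simp only [tpow, signedPerm, Matrix.of_apply]
  split_ifs with h
  · subst h
    simp
  · obtain ⟨a, ha⟩ := Function.ne_iff.1 h
    exact Finset.prod_eq_zero (Finset.mem_univ a) (by simp_all)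

/-- Commuting with tensor powers of a signed permutation matrix, in coordinates. -/
theorem intertwines_signedPerm_iff {n k l : ℕ} (W : Matrix (Fin l → Fin n) (Fin k → Fin n) ℂ)
    (σ : Equiv.Perm (Fin n)) {ε : Fin n → ℝ} (hε : ∀ i, ε i = 1 ∨ ε i = -1) :
    W * tpow n k (signedPerm σ ε) = tpow n l (signedPerm σ ε) * W ↔
      ∀ I J, W (σ ∘ I) (σ ∘ J) = (∏ x, (ε (Sum.elim I J x) : ℂ)) * W I J := by
  have hleft : ∀ I J, (W * tpow n k (signedPerm σ ε)) I (σ ∘ J) =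
      W I J * ∏ a, (ε (J a) : ℂ) := fun I J => by
    simp [Matrix.mul_apply, tpow_signedPerm, σ.injective.comp_left.eq_iff]
  have hright : ∀ I J, (tpow n l (signedPerm σ ε) * W) I J =
      (∏ a, (ε (I a) : ℂ)) * W (σ ∘ I) J := fun I J => by
    simp [Matrix.mul_apply, tpow_signedPerm]
  have hsq : ∀ I : Fin l → Fin n, (∏ a, (ε (I a) : ℂ)) * ∏ a, (ε (I a) : ℂ) = 1 := fun I => by
    rw [← Finset.prod_mul_distrib]
    refine Finset.prod_eq_one fun a _ => ?_
    rcases hε (I a) with h | h <;> simp [h]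
  simp only [Fintype.prod_sum_type, Sum.elim_inl, Sum.elim_inr]
  constructor
  · intro h I J
    have := congrFun (congrFun h I) (σ ∘ J)
    rw [hleft, hright] at this
    linear_combination (- ∏ a, (ε (I a) : ℂ)) * this - W (σ ∘ I) (σ ∘ J) * hsq I
  · intro h
    ext I J
    obtain ⟨J, rfl⟩ : ∃ J', σ ∘ J' = J := ⟨σ.symm ∘ J, by ext; simp⟩
    rw [hleft, hright, h]
    linear_combination (- W I J * ∏ a, (ε (J a) : ℂ)) * hsq I

theorem Dmat_intertwines {n k l : ℕ} {π : Setoid (Fin l ⊕ Fin k)}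
    (hπ : ∀ s ∈ π.classes, Even s.ncard) {g : Matrix (Fin n) (Fin n) ℝ} (hg : g * gᵀ = 1)
    (hent : ∀ i j, g i j ∈ ({-1, 0, 1} : Set ℝ)) :
    Dmat n π * tpow n k g = tpow n l g * Dmat n π := by
  obtain ⟨σ, ε, hε, rfl⟩ := exists_eq_signedPerm hg hent
  rw [intertwines_signedPerm_iff _ _ hε]
  intro I J
  have hker : Setoid.ker (Sum.elim (σ ∘ I) (σ ∘ J)) = Setoid.ker (Sum.elim I J) := by
    rw [← Sum.comp_elim]
    ext x y
    simp [Setoid.ker_def]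
  rw [Dmat_apply, Dmat_apply, hker]
  split_ifs with h
  · rw [mul_one, eq_comm, Finset.prod_comp (fun i => (ε i : ℂ)) (Sum.elim I J)]
    refine Finset.prod_eq_one fun i _ => ?_
    have heven : Even ({x | Sum.elim I J x = i} : Set _).ncard :=
      even_ncard_of_saturated hπ fun x y hxy hx => (h hxy).symm.trans hx
    rw [Set.ncard_eq_toFinset_card', Set.toFinset_ofPred] at heven
    rcases hε i with h1 | h1 <;> simp [h1, heven.neg_one_pow]
  · simp

theorem apply_eq_of_ker_eq {n k l : ℕ} {W : Matrix (Fin l → Fin n) (Fin k → Fin n) ℂ}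
    (hW : ∀ g : Matrix (Fin n) (Fin n) ℝ, g * gᵀ = 1 →
      (∀ i j : Fin n, g i j ∈ ({-1, 0, 1} : Set ℝ)) → W * tpow n k g = tpow n l g * W)
    {I I' : Fin l → Fin n} {J J' : Fin k → Fin n}
    (h : Setoid.ker (Sum.elim I J) = Setoid.ker (Sum.elim I' J')) : W I J = W I' J' := by
  obtain ⟨σ, hσ⟩ := exists_perm_comp_eq_of_ker_eq h
  have hε : ∀ _ : Fin n, (1 : ℝ) = 1 ∨ (1 : ℝ) = -1 := fun _ => Or.inl rfl
  have hWσ := (intertwines_signedPerm_iff W σ hε).1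
    (hW _ (signedPerm_mul_transpose σ hε) (signedPerm_mem σ hε)) I J
  have hI : σ ∘ I = I' := funext fun a => hσ (Sum.inl a)
  have hJ : σ ∘ J = J' := funext fun a => hσ (Sum.inr a)
  simpa [hI, hJ] using hWσ.symm

theorem even_classes_ker_of_apply_ne_zero {n k l : ℕ}
    {W : Matrix (Fin l → Fin n) (Fin k → Fin n) ℂ}
    (hW : ∀ g : Matrix (Fin n) (Fin n) ℝ, g * gᵀ = 1 →
      (∀ i j : Fin n, g i j ∈ ({-1, 0, 1} : Set ℝ)) → W * tpow n k g = tpow n l g * W)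
    {I : Fin l → Fin n} {J : Fin k → Fin n} (h : W I J ≠ 0) :
    ∀ s ∈ (Setoid.ker (Sum.elim I J)).classes, Even s.ncard := by
  rintro s ⟨y, rfl⟩
  set i := Sum.elim I J y with hi
  let ε : Fin n → ℝ := fun j => if j = i then -1 else 1
  have hε : ∀ j, ε j = 1 ∨ ε j = -1 := fun j => by
    by_cases hj : j = i <;> simp [ε, hj]
  have hWε := (intertwines_signedPerm_iff W 1 hε).1
    (hW _ (signedPerm_mul_transpose 1 hε) (signedPerm_mem 1 hε)) I J
  have hprod : ∏ x, (ε (Sum.elim I J x) : ℂ) = 1 := by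
    refine mul_right_cancel₀ h ?_
    rw [← hWε, one_mul]
    rfl
  have hpow : ∏ x, (ε (Sum.elim I J x) : ℂ) =
      (-1) ^ ({x | Sum.elim I J x = i} : Finset (Fin l ⊕ Fin k)).card := by
    simp only [ε, apply_ite Complex.ofReal, Complex.ofReal_neg, Complex.ofReal_one]
    rw [Finset.prod_ite]
    simp
  rw [hpow, neg_one_pow_eq_one_iff_even (by norm_num)] at hprod
  rw [Set.ncard_eq_toFinset_card']
  convert hprod using 2
  ext x
  simp [Setoid.ker_def, hi]

/-- A matrix whose entries depend only on the kernel is a combination of `kerMat`s. -/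
theorem eq_sum_smul_kerMat {n : ℕ} {α β : Type*} [Fintype (Setoid (α ⊕ β))]
    {W : Matrix (α → Fin n) (β → Fin n) ℂ} {c : Setoid (α ⊕ β) → ℂ}
    (hc : ∀ I J, W I J = c (Setoid.ker (Sum.elim I J))) : W = ∑ ρ, c ρ • kerMat n ρ := by
  ext I J
  simp [Matrix.sum_apply, kerMat, hc]

/-- the set of matrices intertwining the tensor power representations of
the hyperoctahedral group `H_n` (real orthogonal matrices with entries in `{-1,0,1}`,
i.e. signed permutation matrices) is the ℂ-linear span of the partition matrices `D_π`
of partitions all of whose blocks have even size. -/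
theorem stmt_14 (n : ℕ) (hn : 0 < n) (k l : ℕ) :
    {W : Matrix (Fin l → Fin n) (Fin k → Fin n) ℂ |
        ∀ g : Matrix (Fin n) (Fin n) ℝ, g * gᵀ = 1 →
          (∀ i j : Fin n, g i j ∈ ({-1, 0, 1} : Set ℝ)) →
          W * tpow n k g = tpow n l g * W} =
      ↑(Submodule.span ℂ
          {D : Matrix (Fin l → Fin n) (Fin k → Fin n) ℂ |
            ∃ π : Setoid (Fin l ⊕ Fin k),
              (∀ s ∈ π.classes, Even s.ncard) ∧ D = Dmat n π}) := by
  refine Set.Subset.antisymm (fun W hW => ?_) fun W hW g hg hent => ?_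
  · have := finite_setoid (Fin l ⊕ Fin k)
    have := Fintype.ofFinite (Setoid (Fin l ⊕ Fin k))
    let c : Setoid (Fin l ⊕ Fin k) → ℂ := fun ρ =>
      if h : ∃ p : (Fin l → Fin n) × (Fin k → Fin n), Setoid.ker (Sum.elim p.1 p.2) = ρ then
        W h.choose.1 h.choose.2 else 0
    have hc : ∀ I J, W I J = c (Setoid.ker (Sum.elim I J)) := fun I J => by
      have h : ∃ p : (Fin l → Fin n) × (Fin k → Fin n),
        Setoid.ker (Sum.elim p.1 p.2) = Setoid.ker (Sum.elim I J) := ⟨(I, J), rfl⟩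
      simp only [c, dif_pos h]
      exact apply_eq_of_ker_eq hW h.choose_spec.symm
    rw [eq_sum_smul_kerMat hc]
    refine Submodule.sum_mem _ fun ρ _ => ?_
    by_cases h0 : c ρ = 0
    · simp [h0]
    refine Submodule.smul_mem _ _ (kerMat_mem_span n ρ ?_)
    by_cases h : ∃ p : (Fin l → Fin n) × (Fin k → Fin n), Setoid.ker (Sum.elim p.1 p.2) = ρ
    · simp only [c, dif_pos h] at h0
      have := even_classes_ker_of_apply_ne_zero hW h0
      rwa [h.choose_spec] at this
    · exact absurd (dif_neg h) h0
  · induction hW using Submodule.span_induction with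
    | mem D hD =>
      obtain ⟨π, hπ, rfl⟩ := hD
      exact Dmat_intertwines hπ hg hent
    | zero => simp
    | add A B _ _ hA hB => rw [Matrix.add_mul, Matrix.mul_add, hA, hB]
    | smul a A _ hA => rw [Matrix.smul_mul, Matrix.mul_smul, hA]
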